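/- arXiv:2201.08286 — 3 statements merged into one kernel-verified Lean document; each statement's English description precedes it below -/
import Mathlib

section
/- Let π^rat_± denote the projections onto A^rat_λ(g) and ι_λ R_λ(g) relative to the direct sum decomposition A_λ(g) = A^rat_λ(g) ∔ ι_λ R_λ(g). Then for any adelic element X ∈ A_λ(g) and any a ∈ ℂP¹, the components of the projections are given by the residue formulas (π^rat₊X)^a(λ_a) = Σ_{b∈ℂP¹} res^μ_b Tr₂( ι_{μ_b} ι_{λ_a} [P₁₂/(μ−λ)] X^b(μ_b)₂ ) dμ and (π^rat₋X)^a(λ_a) = −Σ_{b∈ℂP¹} res^μ_b Tr₂( ι_{λ_a} ι_{μ_b} [P₁₂/(μ−λ)] X^b(μ_b)₂ ) dμ. -/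
/-!
# Residue formulas for the projections `π^rat_±` (rational case)

Relative to the direct sum decomposition `A_λ(g) = A^rat_λ(g) ∔ ι_λ R_λ(g)`, the
projections of an adelic element `X` are given by the residue formulas
`(π^rat₊X)^a(λ_a) = Σ_b res^μ_b Tr₂( ι_{μ_b} ι_{λ_a} [P₁₂/(μ−λ)] X^b(μ_b)₂ ) dμ` and
`(π^rat₋X)^a(λ_a) = −Σ_b res^μ_b Tr₂( ι_{λ_a} ι_{μ_b} [P₁₂/(μ−λ)] X^b(μ_b)₂ ) dμ`.

Since `Tr₂(P₁₂ M₂) = M`, the integrand is the scalar double expansion of `1/(μ−λ)`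
multiplied by the `μ_b`-Laurent series `X^b(μ_b)`.  `ι_{μ_b}ι_{λ_a}` means: expand first
in `λ_a`, then each coefficient in `μ_b`; `ι_{λ_a}ι_{μ_b}` is the opposite order.  The
kernel `1/(μ−λ)` is provided in the two variable orderings via iterated rational function
fields (`Rf2 = RatFunc (RatFunc ℂ)`).
-/

set_option synthInstance.maxHeartbeats 400000
noncomputable section
open Polynomial

abbrev Rf : Type := RatFunc ℂ
abbrev Rf2 : Type := RatFunc Rf
/-- `ℂP¹ = ℂ ∪ {∞}`; `none` is the point at infinity -/
abbrev CP1 : Type := Option ℂ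
abbrev glC (N : ℕ) : Type := Matrix (Fin N) (Fin N) ℂ
abbrev AdeleData (N : ℕ) : Type := CP1 → ℤ → glC N

def laurentCoeffAt {F : Type*} [Field F] (b : F) (f : RatFunc F) (n : ℤ) : F :=
  ((RatFunc.laurent b f : LaurentSeries F)).coeff n

def invSubst {F : Type*} [Field F] (f : RatFunc F) : RatFunc F :=
  (algebraMap F[X] (RatFunc F) f.num.reverse * RatFunc.X ^ f.denom.natDegree) /
    (algebraMap F[X] (RatFunc F) f.denom.reverse * RatFunc.X ^ f.num.natDegree)

/-- `ι_{λ_a}`: coefficient of `λ_a^n` in the Laurent expansion at `a ∈ ℂP¹` -/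
def expC {F : Type*} [Field F] (a : Option F) (f : RatFunc F) (n : ℤ) : F :=
  match a with
  | some b => laurentCoeffAt b f n
  | none => ((invSubst f : LaurentSeries F)).coeff n

/-- a point of `ℂP¹` regarded as a point for expansion over the field `Rf` of rational
functions of the other variable -/
def pt (b : CP1) : Option Rf := b.map (algebraMap ℂ Rf)

/-- the kernel `1/(μ−λ)` with outer variable `μ` (coefficients rational in `λ`) -/
def cMuOuter : Rf2 := (RatFunc.X - RatFunc.C (RatFunc.X : Rf))⁻¹
/-- the kernel `1/(μ−λ)` with outer variable `λ` (coefficients rational in `μ`) -/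
def cLamOuter : Rf2 := (RatFunc.C (RatFunc.X : Rf) - RatFunc.X)⁻¹

/-- `ι_{λ_a}ι_{μ_b}(1/(μ−λ))` : coefficient of `λ_a^t μ_b^m`, expanding first in `μ_b` -/
def dMuFirst (a b : CP1) (t m : ℤ) : ℂ := expC a (expC (pt b) cMuOuter m) t
/-- `ι_{μ_b}ι_{λ_a}(1/(μ−λ))` : coefficient of `λ_a^t μ_b^m`, expanding first in `λ_a` -/
def dLamFirst (a b : CP1) (t m : ℤ) : ℂ := expC b (expC (pt a) cLamOuter t) m

/-- residue of `(Σ_n c_n μ_b^n) dμ` at `b`; at `∞`, `dμ = -μ_∞^{-2} dμ_∞` -/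
def res {V : Type*} [AddCommGroup V] (b : CP1) (c : ℤ → V) : V :=
  match b with
  | some _ => c (-1)
  | none => - c 1

def LaurentBdd {N : ℕ} (X : AdeleData N) : Prop := ∀ a, ∃ M : ℤ, ∀ n, n < M → X a n = 0
def AlmostTaylor {N : ℕ} (X : AdeleData N) : Prop := {a : CP1 | ∃ n, n < 0 ∧ X a n ≠ 0}.Finite
def IsAdele {N : ℕ} (X : AdeleData N) : Prop := LaurentBdd X ∧ AlmostTaylor X
def InArat {N : ℕ} (X : AdeleData N) : Prop := (∀ a n, n < 0 → X a n = 0) ∧ X none 0 = 0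

def iota {N : ℕ} (f : Matrix (Fin N) (Fin N) Rf) : AdeleData N :=
  fun a n => Matrix.of fun i j => expC a (f i j) n

/-- the right-hand side of the `π^rat₊` formula:
`Σ_{b} res^μ_b [ (ι_{μ_b}ι_{λ_a} 1/(μ−λ)) · X^b(μ_b) ] dμ`, coefficient of `λ_a^t`. -/
def projPlusRHS {N : ℕ} (X : AdeleData N) (a : CP1) (t : ℤ) : glC N :=
  ∑ᶠ b : CP1, res b (fun m : ℤ => ∑ᶠ p : ℤ, dLamFirst a b t p • X b (m - p))

/-- the right-hand side of the `π^rat₋` formula: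
`−Σ_{b} res^μ_b [ (ι_{λ_a}ι_{μ_b} 1/(μ−λ)) · X^b(μ_b) ] dμ`, coefficient of `λ_a^t`. -/
def projMinusRHS {N : ℕ} (X : AdeleData N) (a : CP1) (t : ℤ) : glC N :=
  - ∑ᶠ b : CP1, res b (fun m : ℤ => ∑ᶠ p : ℤ, dMuFirst a b t p • X b (m - p))

section Expansion

open scoped RatFunc

variable {F : Type*} [Field F]

theorem polynomial_eval₂_inv_eq (p : F[X]) :
    p.eval₂ HahnSeries.C (HahnSeries.single (-1 : ℤ) (1 : F)) *
        HahnSeries.single 1 1 ^ p.natDegree =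
      ((algebraMap F[X] (RatFunc F) p.reverse : RatFunc F) : LaurentSeries F) := by
  let T : LaurentSeries F := HahnSeries.single (1 : ℤ) (1 : F)
  let U : LaurentSeries F := HahnSeries.single (-1 : ℤ) (1 : F)
  have hUT : U * T = 1 := by simp [U, T, HahnSeries.single_mul_single]
  have hTU : T * U = 1 := by rw [mul_comm, hUT]
  let _ : Invertible T := ⟨U, hUT, hTU⟩
  let _ : Invertible U := ⟨T, hTU, hUT⟩
  have h := Polynomial.eval₂_reverse_mul_pow (HahnSeries.C : F →+* LaurentSeries F) U p
  have h' : p.reverse.eval₂ (HahnSeries.C : F →+* LaurentSeries F) T =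
      ((algebraMap F[X] (RatFunc F) p.reverse : RatFunc F) : LaurentSeries F) := by
    rw [← IsScalarTower.algebraMap_apply F[X] (RatFunc F) (LaurentSeries F)]
    have e : (Polynomial.eval₂RingHom (HahnSeries.C : F →+* LaurentSeries F) T) =
        algebraMap F[X] (LaurentSeries F) := by
      ext x
      · simp [HahnSeries.algebraMap_apply', PowerSeries.algebraMap_apply']
      · simp [T]
    exact DFunLike.congr_fun e _
  change p.eval₂ HahnSeries.C U * T ^ _ = _
  rw [← h, mul_assoc, ← mul_pow, hUT, one_pow, mul_one]
  exact h'

/-- The substitution `X ↦ X⁻¹` on polynomials, with values in Laurent series. -/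
def polynomialInvHom : F[X] →+* LaurentSeries F :=
  Polynomial.eval₂RingHom HahnSeries.C (HahnSeries.single (-1 : ℤ) (1 : F))

theorem polynomialInvHom_mul (p : F[X]) :
    polynomialInvHom p * HahnSeries.single 1 1 ^ p.natDegree =
      ((algebraMap F[X] (RatFunc F) p.reverse : RatFunc F) : LaurentSeries F) :=
  polynomial_eval₂_inv_eq p

theorem polynomialInvHom_injective :
    Function.Injective (polynomialInvHom : F[X] →+* LaurentSeries F) := by
  rw [injective_iff_map_eq_zero]
  intro p hp
  have h := polynomialInvHom_mul p
  rw [hp, zero_mul] at h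
  simpa using h.symm

/-- The Laurent expansion at a point of the projective line, as a ring homomorphism. -/
def expHom : Option F → RatFunc F →+* LaurentSeries F
  | some b => (algebraMap (RatFunc F) (LaurentSeries F)).comp (RatFunc.laurent b).toRingHom
  | none => RatFunc.liftRingHom polynomialInvHom
      (nonZeroDivisors_le_comap_nonZeroDivisors_of_injective _ polynomialInvHom_injective)

theorem expHom_none_eq (f : RatFunc F) : expHom none f = (invSubst f : LaurentSeries F) := by
  have hf : expHom none f = polynomialInvHom f.num / polynomialInvHom f.denom := by
    conv_lhs => rw [← RatFunc.num_div_denom f]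
    exact RatFunc.liftRingHom_apply_div _ _ _ _
  have hT : (HahnSeries.single (1 : ℤ) (1 : F) : LaurentSeries F) ≠ 0 := by simp
  have hd : polynomialInvHom f.denom ≠ 0 :=
    (map_ne_zero_iff _ polynomialInvHom_injective).2 f.denom_ne_zero
  rw [hf, invSubst, map_div₀, map_mul, map_mul, map_pow, map_pow, RatFunc.coe_X,
    ← polynomialInvHom_mul, ← polynomialInvHom_mul]
  field_simp

theorem expC_eq_coeff (a : Option F) (f : RatFunc F) (n : ℤ) :
    expC a f n = (expHom a f).coeff n := by
  cases a with
  | none => rw [expHom_none_eq]; rfl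
  | some b => rfl

@[simp]
theorem expHom_C (a : Option F) (c : F) : expHom a (RatFunc.C c) = HahnSeries.C c := by
  cases a with
  | none =>
    simp [expHom, ← RatFunc.algebraMap_C, polynomialInvHom]
  | some b =>
    have h : algebraMap F[X] (LaurentSeries F) (Polynomial.C c) = HahnSeries.C c := by
      simp [HahnSeries.algebraMap_apply', PowerSeries.algebraMap_apply']
    change algebraMap (RatFunc F) (LaurentSeries F) (RatFunc.laurent b (RatFunc.C c)) = _
    rw [RatFunc.laurent_C, ← RatFunc.algebraMap_C, ← h,
      ← IsScalarTower.algebraMap_apply F[X] (RatFunc F) (LaurentSeries F)]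

@[simp]
theorem expHom_some_X (b : F) :
    expHom (some b) RatFunc.X = HahnSeries.single 1 1 + HahnSeries.C b := by
  rw [← expHom_C (some b)]
  simp [expHom]

@[simp]
theorem expHom_none_X : expHom none (RatFunc.X : RatFunc F) = HahnSeries.single (-1) 1 := by
  simp [expHom, polynomialInvHom]

theorem ratFunc_X_sub_C_ne_zero (c : F) : (RatFunc.X - RatFunc.C c : RatFunc F) ≠ 0 := by
  rw [← RatFunc.algebraMap_X, ← RatFunc.algebraMap_C, ← map_sub]
  exact RatFunc.algebraMap_ne_zero (Polynomial.X_sub_C_ne_zero c)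

theorem expHom_some_inv (b c : F) (h : c ≠ b) :
    expHom (some b) (RatFunc.X - RatFunc.C c)⁻¹ =
      HahnSeries.ofPowerSeries ℤ F
        (-PowerSeries.invUnitsSub (Units.mk0 (c - b) (sub_ne_zero.2 h))) := by
  rw [map_inv₀]
  refine (eq_inv_of_mul_eq_one_right ?_).symm
  have e : expHom (some b) (RatFunc.X - RatFunc.C c) =
      HahnSeries.ofPowerSeries ℤ F (-(PowerSeries.C (c - b) - PowerSeries.X)) := by
    simp only [map_sub, expHom_some_X, expHom_C, map_neg, HahnSeries.ofPowerSeries_C,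
      HahnSeries.ofPowerSeries_X]
    ring
  rw [e, ← map_mul, neg_mul_neg, mul_comm]
  have := PowerSeries.invUnitsSub_mul_sub (Units.mk0 (c - b) (sub_ne_zero.2 h))
  rw [Units.val_mk0] at this
  rw [this, map_one]

theorem expHom_none_inv (c : F) :
    expHom none (RatFunc.X - RatFunc.C c)⁻¹ =
      HahnSeries.single 1 1 * HahnSeries.ofPowerSeries ℤ F (PowerSeries.mk fun n => c ^ n) := by
  rw [map_inv₀]
  refine (eq_inv_of_mul_eq_one_right ?_).symm
  have e : expHom none (RatFunc.X - RatFunc.C c) * HahnSeries.single 1 1 =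
      HahnSeries.ofPowerSeries ℤ F (1 - PowerSeries.C c * PowerSeries.X) := by
    simp [sub_mul]
  have h : (PowerSeries.mk fun n => c ^ n) * (1 - PowerSeries.C c * PowerSeries.X) = 1 := by
    ext n
    cases n <;> simp [mul_sub, ← mul_assoc, PowerSeries.coeff_succ_mul_X, pow_succ,
      PowerSeries.coeff_one]
  rw [← mul_assoc, e, ← map_mul, mul_comm, h, map_one]

theorem coeff_ofPowerSeries_of_neg (f : PowerSeries F) {n : ℤ} (hn : n < 0) :
    (HahnSeries.ofPowerSeries ℤ F f).coeff n = 0 := by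
  rw [PowerSeries.coeff_coe, if_pos hn]

end Expansion

/-- The coefficient of `μ_b ^ m` in the expansion of `1/(μ-λ)` at `μ = b`. -/
def kernelCoeff (b : CP1) (m : ℤ) : Rf := expC (pt b) cMuOuter m

theorem dMuFirst_eq (a b : CP1) (t m : ℤ) :
    dMuFirst a b t m = (expHom a (kernelCoeff b m)).coeff t :=
  expC_eq_coeff _ _ _

theorem dLamFirst_eq (a b : CP1) (t m : ℤ) :
    dLamFirst a b t m = -(expHom b (kernelCoeff a t)).coeff m := by
  have e {K : Type} [Field K] (x y : K) : (x - y)⁻¹ = -(y - x)⁻¹ := by rw [← neg_sub, inv_neg]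
  have h : cLamOuter = -cMuOuter := e (K := Rf2) _ _
  have h' : expC (pt a) cLamOuter t = -kernelCoeff a t := by
    rw [kernelCoeff, expC_eq_coeff, expC_eq_coeff, h, map_neg, HahnSeries.coeff_neg]
  rw [dLamFirst, h', expC_eq_coeff, map_neg, HahnSeries.coeff_neg]

/-- The least exponent occurring at a point of `CP1` in an element of `A^rat`. -/
def regularOrder : CP1 → ℤ
  | some _ => 0
  | none => 1

/-- The exponent whose coefficient enters the residue at a point of `CP1`. -/
def residueIndex : CP1 → ℤ
  | some _ => -1
  | none => 1

/-- The sign with which the coefficient enters the residue at a point of `CP1`. -/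
def residueSign : CP1 → ℤ
  | some _ => 1
  | none => -1

theorem residueIndex_eq (b : CP1) : residueIndex b = 2 * regularOrder b - 1 := by
  cases b <;> rfl

theorem residueSign_mul_self (b : CP1) : residueSign b * residueSign b = 1 := by
  cases b <;> rfl

theorem res_eq {V : Type*} [AddCommGroup V] (b : CP1) (c : ℤ → V) :
    res b c = residueSign b • c (residueIndex b) := by
  cases b <;> simp [res, residueSign, residueIndex]

theorem X_sub_C_X_ne (b : ℂ) : (RatFunc.X : Rf) ≠ RatFunc.C b :=
  sub_ne_zero.1 (ratFunc_X_sub_C_ne_zero b)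

theorem kernelCoeff_some (b : ℂ) (n : ℕ) :
    kernelCoeff (some b) n = -(RatFunc.X - RatFunc.C b)⁻¹ ^ (n + 1) := by
  have hp : pt (some b) = some (RatFunc.C b) := by simp [pt, RatFunc.algebraMap_eq_C]
  rw [kernelCoeff, expC_eq_coeff, hp, cMuOuter, expHom_some_inv _ _ (X_sub_C_X_ne b), map_neg,
    HahnSeries.coeff_neg, HahnSeries.ofPowerSeries_apply_coeff]
  simp

theorem kernelCoeff_none (n : ℕ) : kernelCoeff none (n + 1) = RatFunc.X ^ n := by
  have hp : pt none = none := rfl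
  rw [kernelCoeff, expC_eq_coeff, hp, cMuOuter, expHom_none_inv, add_comm,
    add_comm, HahnSeries.coeff_single_mul_add, HahnSeries.ofPowerSeries_apply_coeff]
  simp

theorem kernelCoeff_of_lt {b : CP1} {m : ℤ} (hm : m < regularOrder b) : kernelCoeff b m = 0 := by
  cases b with
  | none =>
    have hp : pt none = none := rfl
    have hm' : m - 1 < 0 := by simp only [regularOrder] at hm; lia
    rw [kernelCoeff, expC_eq_coeff, hp, cMuOuter, expHom_none_inv, HahnSeries.coeff_single_mul,
      coeff_ofPowerSeries_of_neg _ hm', mul_zero]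
  | some b =>
    have hp : pt (some b) = some (RatFunc.C b) := by simp [pt, RatFunc.algebraMap_eq_C]
    rw [kernelCoeff, expC_eq_coeff, hp, cMuOuter, expHom_some_inv _ _ (X_sub_C_X_ne b),
      coeff_ofPowerSeries_of_neg _ hm]

theorem exists_eq_of_regularOrder_le {b : CP1} {m : ℤ} (hm : regularOrder b ≤ m) :
    ∃ n : ℕ, m = regularOrder b + n :=
  ⟨(m - regularOrder b).toNat, by lia⟩

theorem expHom_kernelCoeff_self {a : CP1} {t : ℤ} (ht : regularOrder a ≤ t) :
    expHom a (kernelCoeff a t) =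
      HahnSeries.single (residueIndex a - t) (-(residueSign a : ℂ)) := by
  obtain ⟨n, rfl⟩ := exists_eq_of_regularOrder_le ht
  cases a with
  | none =>
    simp only [regularOrder, residueIndex, residueSign, add_comm (1 : ℤ), kernelCoeff_none]
    simp
  | some a =>
    simp only [regularOrder, residueIndex, residueSign, zero_add, kernelCoeff_some]
    simp only [map_neg, map_pow, map_inv₀, map_sub, expHom_some_X, expHom_C, add_sub_cancel_right,
      HahnSeries.inv_single, HahnSeries.single_pow]
    have e : -1 - (n : ℤ) = (n + 1) • (-1) := by simp; ring
    simp [e]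

theorem expHom_none_inv_pow (c : ℂ) (n : ℕ) :
    ∃ f : PowerSeries ℂ, PowerSeries.constantCoeff f = 1 ∧
      expHom none ((RatFunc.X - RatFunc.C c)⁻¹ ^ n : Rf) =
        HahnSeries.single (n : ℤ) 1 * HahnSeries.ofPowerSeries ℤ ℂ f := by
  refine ⟨(PowerSeries.mk fun n => c ^ n) ^ n, ?_, ?_⟩
  · rw [map_pow, PowerSeries.constantCoeff_mk, pow_zero, one_pow]
  · rw [map_pow, expHom_none_inv, mul_pow, map_pow, HahnSeries.single_pow]
    simp

theorem coeff_expHom_kernelCoeff_of_ne {a b : CP1} (hab : a ≠ b) (t : ℤ) {m : ℤ}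
    (hm : m < regularOrder b) : (expHom b (kernelCoeff a t)).coeff m = 0 := by
  by_cases ht : t < regularOrder a
  · simp [kernelCoeff_of_lt ht]
  obtain ⟨n, rfl⟩ := exists_eq_of_regularOrder_le (not_lt.1 ht)
  match a, b with
  | none, none => exact absurd rfl hab
  | none, some b =>
    have e : expHom (some b) (RatFunc.X : Rf) =
        HahnSeries.ofPowerSeries ℤ ℂ (PowerSeries.X + PowerSeries.C b) := by
      simp
    rw [regularOrder, add_comm, kernelCoeff_none, map_pow, e, ← map_pow,
      coeff_ofPowerSeries_of_neg _ hm]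
  | some a, none =>
    obtain ⟨f, -, hf⟩ := expHom_none_inv_pow a (n + 1)
    have hm' : m - ((n + 1 : ℕ) : ℤ) < 0 := by simp only [regularOrder] at hm; lia
    rw [regularOrder, zero_add, kernelCoeff_some, map_neg, hf, HahnSeries.coeff_neg,
      HahnSeries.coeff_single_mul, coeff_ofPowerSeries_of_neg _ hm', mul_zero, neg_zero]
  | some a, some b =>
    have h : a ≠ b := fun h => hab (by rw [h])
    rw [regularOrder, zero_add, kernelCoeff_some, map_neg, map_pow, expHom_some_inv _ _ h,
      ← map_pow, ← map_neg, coeff_ofPowerSeries_of_neg _ hm]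

theorem support_coeff_mul_subset {R : Type*} [Semiring R] (x y : LaurentSeries R) (m : ℤ) :
    (Function.support fun p : ℤ => x.coeff p * y.coeff (m - p)) ⊆
      (Finset.antidiagonal x.isPWO_support y.isPWO_support m).image Prod.fst := by
  intro p hp
  rw [Finset.coe_image]
  exact ⟨(p, m - p), Finset.mem_antidiagonal.2
    ⟨left_ne_zero_of_mul hp, right_ne_zero_of_mul hp, by simp⟩, rfl⟩

theorem coeff_mul_eq_finsum {R : Type*} [Semiring R] (x y : LaurentSeries R) (m : ℤ) :
    (x * y).coeff m = ∑ᶠ p : ℤ, x.coeff p * y.coeff (m - p) := by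
  rw [HahnSeries.coeff_mul,
    finsum_eq_finsetSum_of_support_subset _ (support_coeff_mul_subset x y m), Finset.sum_image]
  · refine Finset.sum_congr rfl fun p hp => ?_
    rw [← (Finset.mem_antidiagonal.1 hp).2.2, add_sub_cancel_left]
  · intro p hp q hq h
    have hp' := (Finset.mem_antidiagonal.1 hp).2.2
    have hq' := (Finset.mem_antidiagonal.1 hq).2.2
    ext
    · exact h
    · lia

/-- The residue at `b` of the product of two Laurent series vanishes if both are regular there,
where at infinity regularity of a function means vanishing. -/
theorem coeff_mul_residueIndex_eq_zero {b : CP1} {x y : LaurentSeries ℂ}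
    (hx : ∀ n < regularOrder b, x.coeff n = 0) (hy : ∀ n < regularOrder b, y.coeff n = 0) :
    (x * y).coeff (residueIndex b) = 0 := by
  rw [HahnSeries.coeff_mul]
  refine Finset.sum_eq_zero fun p hp => ?_
  have h := (Finset.mem_antidiagonal.1 hp).2.2
  rw [residueIndex_eq] at h
  by_cases h1 : p.1 < regularOrder b
  · rw [hx _ h1, zero_mul]
  · rw [hy _ (by lia), mul_zero]

theorem residueSign_mul_coeff_kernelCoeff_mul (a b : CP1) (t : ℤ) {y : LaurentSeries ℂ}
    (hy : ∀ n < regularOrder b, y.coeff n = 0) :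
    (residueSign b : ℂ) * (expHom b (kernelCoeff a t) * y).coeff (residueIndex b) =
      if b = a then -y.coeff t else 0 := by
  split_ifs with hab
  · subst hab
    by_cases ht : t < regularOrder b
    · simp [kernelCoeff_of_lt ht, hy _ ht]
    · rw [expHom_kernelCoeff_self (not_lt.1 ht), HahnSeries.coeff_single_mul, sub_sub_cancel,
        ← mul_assoc, mul_neg, ← Int.cast_mul, residueSign_mul_self, Int.cast_one, neg_one_mul]
  · rw [coeff_mul_residueIndex_eq_zero
      (fun n hn => coeff_expHom_kernelCoeff_of_ne (Ne.symm hab) t hn) hy, mul_zero]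

/-- The span of the functions into which partial fractions decompose rational functions. -/
def kernelSpan : Submodule ℂ Rf :=
  Submodule.span ℂ (Set.range fun p : CP1 × ℤ => kernelCoeff p.1 p.2)

theorem kernelCoeff_mem_kernelSpan (c : CP1) (n : ℤ) : kernelCoeff c n ∈ kernelSpan :=
  Submodule.subset_span ⟨(c, n), rfl⟩

theorem X_pow_mem_kernelSpan (n : ℕ) : (RatFunc.X : Rf) ^ n ∈ kernelSpan := by
  rw [← kernelCoeff_none]
  exact kernelCoeff_mem_kernelSpan _ _

theorem inv_pow_mem_kernelSpan (c : ℂ) (n : ℕ) :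
    (RatFunc.X - RatFunc.C c : Rf)⁻¹ ^ (n + 1) ∈ kernelSpan := by
  rw [← neg_neg (_ ^ _), ← kernelCoeff_some]
  exact neg_mem (kernelCoeff_mem_kernelSpan _ _)

theorem C_mul_mem_kernelSpan (z : ℂ) {f : Rf} (hf : f ∈ kernelSpan) :
    RatFunc.C z * f ∈ kernelSpan := by
  rw [← RatFunc.smul_eq_C_mul]
  exact Submodule.smul_mem _ _ hf

theorem algebraMap_mem_kernelSpan (p : ℂ[X]) : algebraMap ℂ[X] Rf p ∈ kernelSpan := by
  induction p using Polynomial.induction_on' with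
  | add p q hp hq => rw [map_add]; exact add_mem hp hq
  | monomial n z =>
    rw [← Polynomial.C_mul_X_pow_eq_monomial, map_mul, map_pow, RatFunc.algebraMap_C,
      RatFunc.algebraMap_X]
    exact C_mul_mem_kernelSpan z (X_pow_mem_kernelSpan n)

theorem X_pow_mul_inv_mem_kernelSpan (c : ℂ) (n : ℕ) :
    (RatFunc.X : Rf) ^ n * (RatFunc.X - RatFunc.C c)⁻¹ ∈ kernelSpan := by
  induction n with
  | zero => simpa using inv_pow_mem_kernelSpan c 0
  | succ n ih =>
    have h := ratFunc_X_sub_C_ne_zero c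
    have e : (RatFunc.X : Rf) ^ (n + 1) * (RatFunc.X - RatFunc.C c)⁻¹ =
        RatFunc.X ^ n + RatFunc.C c * (RatFunc.X ^ n * (RatFunc.X - RatFunc.C c)⁻¹) := by
      field_simp
      ring
    rw [e]
    exact add_mem (X_pow_mem_kernelSpan n) (C_mul_mem_kernelSpan c ih)

theorem inv_pow_mul_inv_mem_kernelSpan (c d : ℂ) (n : ℕ) :
    (RatFunc.X - RatFunc.C d : Rf)⁻¹ ^ n * (RatFunc.X - RatFunc.C c)⁻¹ ∈ kernelSpan := by
  by_cases hcd : d = c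
  · rw [hcd, ← pow_succ]
    exact inv_pow_mem_kernelSpan c n
  induction n with
  | zero => simpa using inv_pow_mem_kernelSpan c 0
  | succ n ih =>
    have hc := ratFunc_X_sub_C_ne_zero c
    have hd := ratFunc_X_sub_C_ne_zero d
    have e : (RatFunc.X - RatFunc.C d : Rf)⁻¹ ^ (n + 1) * (RatFunc.X - RatFunc.C c)⁻¹ =
        RatFunc.C (d - c)⁻¹ * ((RatFunc.X - RatFunc.C d)⁻¹ ^ (n + 1) -
          (RatFunc.X - RatFunc.C d)⁻¹ ^ n * (RatFunc.X - RatFunc.C c)⁻¹) := by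
      have hdc : (RatFunc.C d - RatFunc.C c : Rf) ≠ 0 :=
        sub_ne_zero.2 fun h => hcd (RatFunc.C_injective h)
      have hsub : (RatFunc.C d - RatFunc.C c : Rf) =
          (RatFunc.X - RatFunc.C c) - (RatFunc.X - RatFunc.C d) := by ring
      rw [map_inv₀, map_sub, hsub]
      rw [hsub] at hdc
      generalize (RatFunc.X - RatFunc.C c : Rf) = B at *
      generalize (RatFunc.X - RatFunc.C d : Rf) = A at *
      simp only [inv_pow, pow_succ]
      field_simp
    rw [e]
    exact C_mul_mem_kernelSpan _ (sub_mem (inv_pow_mem_kernelSpan d n) ih)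

theorem mul_inv_mem_kernelSpan (c : ℂ) {f : Rf} (hf : f ∈ kernelSpan) :
    f * (RatFunc.X - RatFunc.C c)⁻¹ ∈ kernelSpan := by
  induction hf using Submodule.span_induction with
  | mem f hf =>
    obtain ⟨⟨d, m⟩, rfl⟩ := hf
    by_cases hm : m < regularOrder d
    · simp [kernelCoeff_of_lt hm]
    obtain ⟨n, rfl⟩ := exists_eq_of_regularOrder_le (not_lt.1 hm)
    cases d with
    | none =>
      simp only [regularOrder, add_comm (1 : ℤ), kernelCoeff_none]
      exact X_pow_mul_inv_mem_kernelSpan c n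
    | some d =>
      simp only [regularOrder, zero_add, kernelCoeff_some, neg_mul]
      exact neg_mem (inv_pow_mul_inv_mem_kernelSpan c d (n + 1))
  | zero => simp
  | add f g _ _ hf hg => rw [add_mul]; exact add_mem hf hg
  | smul z f _ hf => rw [smul_mul_assoc]; exact Submodule.smul_mem _ _ hf

theorem kernelSpan_eq_top : kernelSpan = ⊤ := by
  have h (s : Multiset ℂ) (f : Rf) (hf : f ∈ kernelSpan) :
      f * (algebraMap ℂ[X] Rf (s.map fun c => Polynomial.X - Polynomial.C c).prod)⁻¹ ∈
        kernelSpan := by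
    induction s using Multiset.induction_on generalizing f with
    | empty => simpa using hf
    | cons c s ih =>
      rw [Multiset.map_cons, Multiset.prod_cons, map_mul, mul_inv, ← mul_assoc, map_sub,
        RatFunc.algebraMap_X, RatFunc.algebraMap_C]
      exact ih _ (mul_inv_mem_kernelSpan c hf)
  refine eq_top_iff.2 fun f _ => ?_
  have hden : f.denom = (f.denom.roots.map fun c => Polynomial.X - Polynomial.C c).prod := by
    exact (IsAlgClosed.splits f.denom).eq_prod_roots_of_monic (RatFunc.monic_denom f)
  rw [← RatFunc.num_div_denom f, div_eq_mul_inv, hden]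
  exact h _ _ (algebraMap_mem_kernelSpan _)

/-- Partial fraction decomposition, as an induction principle. -/
theorem kernelCoeff_induction {P : Rf → Prop} (kernelCoeff : ∀ c n, P (kernelCoeff c n))
    (add : ∀ f g, P f → P g → P (f + g)) (C_mul : ∀ z f, P f → P (RatFunc.C z * f)) (f : Rf) :
    P f := by
  have hf : f ∈ kernelSpan := kernelSpan_eq_top ▸ Submodule.mem_top
  induction hf using Submodule.span_induction with
  | mem f hf => obtain ⟨p, rfl⟩ := hf; exact kernelCoeff _ _
  | zero => simpa using C_mul 0 _ (kernelCoeff none 0)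
  | add f g _ _ hf hg => exact add f g hf hg
  | smul z f _ hf => rw [RatFunc.smul_eq_C_mul]; exact C_mul z f hf

/-- The function `w` has finite support and sum `v`. -/
def HasFinsum {α : Type*} (w : α → ℂ) (v : ℂ) : Prop :=
  (Function.support w).Finite ∧ ∑ᶠ x, w x = v

namespace HasFinsum

variable {α : Type*} {w w' : α → ℂ} {v v' : ℂ}

theorem add (h : HasFinsum w v) (h' : HasFinsum w' v') :
    HasFinsum (fun x => w x + w' x) (v + v') :=
  ⟨(h.1.union h'.1).subset (Function.support_add w w'), by
    rw [finsum_add_distrib h.1 h'.1, h.2, h'.2]⟩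

theorem mul_left (z : ℂ) (h : HasFinsum w v) : HasFinsum (fun x => z * w x) (z * v) :=
  ⟨h.1.subset fun _ hx => right_ne_zero_of_mul hx, by rw [← h.2]; exact (mul_finsum w z).symm⟩

theorem of_finset (s : Finset α) (hs : ∀ x ∉ s, w x = 0) (hv : ∑ x ∈ s, w x = v) :
    HasFinsum w v := by
  have h : Function.support w ⊆ s := fun x hx => by
    by_contra hxs
    exact hx (hs x hxs)
  exact ⟨s.finite_toSet.subset h, by rw [finsum_eq_finsetSum_of_support_subset w h, hv]⟩

theorem single (c : α) (hs : ∀ x, x ≠ c → w x = 0) (hv : w c = v) : HasFinsum w v :=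
  of_finset {c} (fun x hx => hs x (by simpa using hx)) (by simpa using hv)

end HasFinsum

theorem coeff_expHom_C_mul (b : CP1) (z : ℂ) (D : LaurentSeries ℂ) (f : Rf) (m : ℤ) :
    (D * expHom b (RatFunc.C z * f)).coeff m = z * (D * expHom b f).coeff m := by
  rw [map_mul, expHom_C, mul_left_comm, HahnSeries.C_apply, HahnSeries.coeff_single_zero_mul]

/-- Additive and homogeneous behaviour of residue sums allows checking them on partial
fractions. -/
theorem hasFinsum_of_kernelCoeff (D : CP1 → LaurentSeries ℂ) (V : Rf → ℂ)
    (hV : ∀ f g, V (f + g) = V f + V g) (hV' : ∀ z f, V (RatFunc.C z * f) = z * V f)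
    (h : ∀ c n, HasFinsum (fun b => (residueSign b : ℂ) *
      (D b * expHom b (kernelCoeff c n)).coeff (residueIndex b)) (V (kernelCoeff c n)))
    (f : Rf) :
    HasFinsum (fun b => (residueSign b : ℂ) *
      (D b * expHom b f).coeff (residueIndex b)) (V f) := by
  induction f using kernelCoeff_induction with
  | kernelCoeff c n => exact h c n
  | add f g hf hg =>
    simpa only [map_add, mul_add, HahnSeries.coeff_add, hV] using hf.add hg
  | C_mul z f hf =>
    simpa only [coeff_expHom_C_mul, hV', mul_left_comm] using hf.mul_left z

/-- The residue theorem on the projective line. -/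
theorem hasFinsum_residue (f : Rf) :
    HasFinsum (fun b => (residueSign b : ℂ) * (expHom b f).coeff (residueIndex b)) 0 := by
  have key := hasFinsum_of_kernelCoeff (fun _ => 1) (fun _ => 0) (by simp) (by simp) ?_ f
  · simpa only [one_mul] using key
  intro c m
  simp only [one_mul]
  by_cases hm : m < regularOrder c
  · exact HasFinsum.of_finset ∅ (by simp [kernelCoeff_of_lt hm]) rfl
  cases c with
  | none =>
    refine HasFinsum.single none (fun b hb => ?_) ?_
    · cases b with
      | none => exact absurd rfl hb
      | some b =>
        rw [coeff_expHom_kernelCoeff_of_ne (Ne.symm hb) m (by simp [residueIndex, regularOrder]),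
          mul_zero]
    · rw [expHom_kernelCoeff_self (not_lt.1 hm), HahnSeries.coeff_single_of_ne, mul_zero]
      simp only [regularOrder] at hm
      lia
  | some c =>
    refine HasFinsum.of_finset {some c, none} (fun b hb => ?_) ?_
    · cases b with
      | none => simp at hb
      | some b =>
        rw [coeff_expHom_kernelCoeff_of_ne (fun h => hb (by simp [h])) m
          (by simp [residueIndex, regularOrder]), mul_zero]
    · rw [Finset.sum_pair (by simp), expHom_kernelCoeff_self (not_lt.1 hm)]
      obtain ⟨n, rfl⟩ := exists_eq_of_regularOrder_le (not_lt.1 hm)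
      obtain ⟨f, hf0, hf⟩ := expHom_none_inv_pow c (n + 1)
      simp only [regularOrder, zero_add, kernelCoeff_some, residueSign, residueIndex, map_neg, hf,
        HahnSeries.coeff_neg, HahnSeries.coeff_single_mul]
      cases n with
      | zero =>
        have h0 := HahnSeries.ofPowerSeries_apply_coeff (Γ := ℤ) f 0
        rw [Nat.cast_zero, PowerSeries.coeff_zero_eq_constantCoeff_apply, hf0] at h0
        simp [h0]
      | succ n =>
        rw [coeff_ofPowerSeries_of_neg _ (by push_cast; lia), HahnSeries.coeff_single_of_ne]
        · simp
        · push_cast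
          lia

/-- The series `∑ m, dMuFirst a b t m μ_b ^ m`. -/
def muFirstSeries (a b : CP1) (t : ℤ) : LaurentSeries ℂ :=
  HahnSeries.ofSuppBddBelow (dMuFirst a b t) <|
    ⟨regularOrder b, fun m hm => not_lt.1 fun h => hm <| by
      simp [dMuFirst_eq, kernelCoeff_of_lt h]⟩

theorem coeff_muFirstSeries (a b : CP1) (t m : ℤ) :
    (muFirstSeries a b t).coeff m = (expHom a (kernelCoeff b m)).coeff t :=
  dMuFirst_eq a b t m

theorem coeff_muFirstSeries_of_lt (a : CP1) {b : CP1} (t : ℤ) {m : ℤ} (hm : m < regularOrder b) :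
    (muFirstSeries a b t).coeff m = 0 := by
  simp [coeff_muFirstSeries, kernelCoeff_of_lt hm]

theorem hasFinsum_muFirstSeries (a : CP1) (t : ℤ) (f : Rf) :
    HasFinsum (fun b => (residueSign b : ℂ) *
      (muFirstSeries a b t * expHom b f).coeff (residueIndex b)) (-(expHom a f).coeff t) := by
  refine hasFinsum_of_kernelCoeff _ (fun f => -(expHom a f).coeff t) (fun f g => ?_)
    (fun z f => ?_) (fun c m => ?_) f
  · rw [map_add, HahnSeries.coeff_add, neg_add]
  · simp
  · by_cases hm : m < regularOrder c
    · exact HasFinsum.of_finset ∅ (by simp [kernelCoeff_of_lt hm]) (by simp [kernelCoeff_of_lt hm])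
    refine HasFinsum.single c (fun b hb => ?_) ?_
    · rw [coeff_mul_residueIndex_eq_zero (fun n hn => coeff_muFirstSeries_of_lt a t hn)
        (fun n hn => coeff_expHom_kernelCoeff_of_ne (Ne.symm hb) m hn), mul_zero]
    · rw [expHom_kernelCoeff_self (not_lt.1 hm), HahnSeries.coeff_mul_single, sub_sub_cancel,
        coeff_muFirstSeries, mul_neg, mul_neg, mul_left_comm, ← Int.cast_mul,
        residueSign_mul_self, Int.cast_one, mul_one]

theorem hasFinsum_projMinus (a : CP1) (t : ℤ) (f : Rf) (y : CP1 → LaurentSeries ℂ)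
    (hy : ∀ b, ∀ n < regularOrder b, (y b).coeff n = 0) :
    HasFinsum (fun b => (residueSign b : ℂ) *
      (muFirstSeries a b t * (y b + expHom b f)).coeff (residueIndex b))
      (-(expHom a f).coeff t) := by
  have h (b : CP1) : (muFirstSeries a b t * y b).coeff (residueIndex b) = 0 :=
    coeff_mul_residueIndex_eq_zero (fun n hn => coeff_muFirstSeries_of_lt a t hn) (hy b)
  simpa only [mul_add, HahnSeries.coeff_add, h, zero_add] using hasFinsum_muFirstSeries a t f

theorem hasFinsum_projPlus (a : CP1) (t : ℤ) (f : Rf) (y : CP1 → LaurentSeries ℂ)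
    (hy : ∀ b, ∀ n < regularOrder b, (y b).coeff n = 0) :
    HasFinsum (fun b => (residueSign b : ℂ) *
      (-expHom b (kernelCoeff a t) * (y b + expHom b f)).coeff (residueIndex b))
      ((y a).coeff t) := by
  have h₁ : HasFinsum (fun b => (residueSign b : ℂ) *
      (expHom b (kernelCoeff a t) * y b).coeff (residueIndex b)) (-(y a).coeff t) :=
    HasFinsum.single a
      (fun b hb => by rw [residueSign_mul_coeff_kernelCoeff_mul a b t (hy b), if_neg hb])
      (by rw [residueSign_mul_coeff_kernelCoeff_mul a a t (hy a), if_pos rfl])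
  have h₂ := (h₁.add (hasFinsum_residue (kernelCoeff a t * f))).mul_left (-1)
  simpa only [neg_mul, one_mul, mul_neg, mul_add, HahnSeries.coeff_neg, HahnSeries.coeff_add,
    map_mul, add_zero, neg_neg, neg_add] using h₂

theorem matrix_finsum_apply {α : Type*} {N : ℕ} {M : α → glC N}
    (h : ∀ i j, (Function.support fun x => M x i j).Finite) (i j : Fin N) :
    (∑ᶠ x, M x) i j = ∑ᶠ x, M x i j := by
  have hM : (Function.support M).Finite := by
    refine (Set.finite_iUnion fun i => Set.finite_iUnion fun j => h i j).subset fun x hx => ?_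
    by_contra hx'
    simp only [Set.mem_iUnion, not_exists, Function.notMem_support] at hx'
    exact hx (Matrix.ext hx')
  exact (Matrix.entryAddMonoidHom ℂ i j).map_finsum hM

theorem finsum_res_eq {N : ℕ} {X : AdeleData N} {d : CP1 → ℤ → ℂ} {Z : glC N}
    (D : CP1 → LaurentSeries ℂ) (x : Fin N → Fin N → CP1 → LaurentSeries ℂ)
    (hD : ∀ b m, d b m = (D b).coeff m) (hx : ∀ b n i j, X b n i j = (x i j b).coeff n)
    (h : ∀ i j, HasFinsum (fun b => (residueSign b : ℂ) *
      (D b * x i j b).coeff (residueIndex b)) (Z i j)) :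
    ∑ᶠ b : CP1, res b (fun m : ℤ => ∑ᶠ p : ℤ, d b p • X b (m - p)) = Z := by
  have e (b : CP1) (i j : Fin N) :
      res b (fun m : ℤ => ∑ᶠ p : ℤ, d b p • X b (m - p)) i j =
        (residueSign b : ℂ) * (D b * x i j b).coeff (residueIndex b) := by
    rw [res_eq, Matrix.smul_apply, matrix_finsum_apply, coeff_mul_eq_finsum, zsmul_eq_mul]
    · simp only [Matrix.smul_apply, smul_eq_mul, hD, hx]
    · intro i j
      simp only [Matrix.smul_apply, smul_eq_mul, hD, hx]
      exact (Finset.finite_toSet _).subset (support_coeff_mul_subset _ _ _)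
  ext i j
  rw [matrix_finsum_apply]
  · simp only [e]
    exact (h i j).2
  · intro i j
    simp only [e]
    exact (h i j).1

/-- for any adelic element `X` and any decomposition `X = Y + ι_λ f`
with `Y ∈ A^rat_λ(g)` and `f` rational, the two summands (i.e. the projections
`π^rat₊ X` and `π^rat₋ X`) are given by the residue formulas. -/
theorem rational_projection_formulas (N : ℕ) (X : AdeleData N) (hX : IsAdele X)
    (Y : AdeleData N) (f : Matrix (Fin N) (Fin N) Rf)
    (hY : InArat Y) (hdec : ∀ a n, X a n = Y a n + iota f a n) :
    (∀ (a : CP1) (t : ℤ), Y a t = projPlusRHS X a t) ∧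
    (∀ (a : CP1) (t : ℤ), iota f a t = projMinusRHS X a t) := by
  have hY' (b : CP1) (n : ℤ) (hn : n < regularOrder b) : Y b n = 0 := by
    rcases lt_or_ge n 0 with h | h
    · exact hY.1 b n h
    · cases b with
      | none =>
        obtain rfl : n = 0 := by simp only [regularOrder] at hn; lia
        exact hY.2
      | some b => exact absurd hn (not_lt.2 h)
  let y (i j : Fin N) (b : CP1) : LaurentSeries ℂ :=
    HahnSeries.ofSuppBddBelow (fun n => Y b n i j) <|
      ⟨regularOrder b, fun n hn => not_lt.1 fun h => hn <| by simp [hY' b n h]⟩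
  have hy (i j : Fin N) (b : CP1) (n : ℤ) (hn : n < regularOrder b) : (y i j b).coeff n = 0 :=
    congrFun₂ (hY' b n hn) i j
  have hf (b : CP1) (n : ℤ) (i j : Fin N) : iota f b n i j = (expHom b (f i j)).coeff n :=
    expC_eq_coeff b (f i j) n
  have hx (b : CP1) (n : ℤ) (i j : Fin N) :
      X b n i j = (y i j b + expHom b (f i j)).coeff n := by
    rw [hdec, Matrix.add_apply, hf, HahnSeries.coeff_add]
    rfl
  refine ⟨fun a t => ?_, fun a t => ?_⟩
  · refine (finsum_res_eq (fun b => -expHom b (kernelCoeff a t)) _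
      (fun b m => dLamFirst_eq a b t m) hx fun i j => ?_).symm
    exact hasFinsum_projPlus a t (f i j) (y i j) (hy i j)
  · rw [projMinusRHS, finsum_res_eq (Z := -iota f a t) (d := fun b => dMuFirst a b t)
      (fun b => muFirstSeries a b t) _ (fun _ _ => rfl) hx fun i j => ?_, neg_neg]
    rw [Matrix.neg_apply, hf]
    exact hasFinsum_projMinus a t (f i j) (y i j) (hy i j)

end
end

section
/- Let a ∈ ℂ and let X(μ_a) = Σ_{n=−N}^∞ X_n μ_a^n be a gl_N(ℂ)-valued formal Laurent series in μ_a = μ − a. Then ι_{μ_a} Tr₂( r^trig₁₂(λ,μ) X(μ_a)₂ ) = − Σ_{r=−N}^∞ μ_a^r ( (λ_a^{−r} + a λ_a^{−r−1}) X(λ_a) )^trig_−, where the rational factor μ/(μ−λ) in r^trig is expanded as the series (μ_a + a)·Σ_{s≥0} μ_a^s λ_a^{−s−1} changed in sign, i.e. ι_{μ_a}(1/(μ−λ)) = −Σ_{s≥0} μ_a^s λ_a^{−s−1}; at a = 0 this reads ι_μ Tr₂( r^trig₁₂(λ,μ) X(μ)₂ ) = − Σ_{r=−N}^∞ μ^r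 ( λ^{−r} X(λ) )^trig_−. Similarly, for X(μ_∞) = Σ_{n=−N}^∞ X_n μ_∞^n a Laurent series at infinity, ι_{μ_∞} Tr₂( r^trig₁₂(λ,μ) X(μ_∞)₂ ) = Σ_{r=−N}^∞ μ_∞^r ( λ_∞^{−r} X(λ_∞) )^trig_−, where ι_{μ_∞}(1/(μ−λ)) = Σ_{s≥0} μ_∞^{s+1} λ_∞^{−s}. -/
/-!
# Expansion lemma for the trigonometric kernel

For `a ∈ ℂ` and a `gl_N(ℂ)`-valued Laurent series `X(μ_a) = Σ_{n≥−N} X_n μ_a^n`: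
`ι_{μ_a} Tr₂( r^trig₁₂(λ,μ) X(μ_a)₂ ) = − Σ_{r≥−N} μ_a^r ( (λ_a^{−r} + a λ_a^{−r−1}) X(λ_a) )^trig_−`,
where the scalar factor `μ/(μ−λ)` of `r^trig` is expanded as
`−(μ_a + a)·Σ_{s≥0} μ_a^s λ_a^{−s−1}` (i.e. `ι_{μ_a}(1/(μ−λ)) = −Σ_{s≥0} μ_a^s λ_a^{−s−1}`),
and `Tr₂(r^trig₁₂ M₂) = (μ/(μ−λ))M − (P⁻+½P⁰)M`.  Similarly at infinity with
`ι_{μ_∞}(1/(μ−λ)) = Σ_{s≥0} μ_∞^{s+1} λ_∞^{−s}`, so `ι_{μ_∞}(μ/(μ−λ)) = Σ_{s≥0} μ_∞^s λ_∞^{−s}`: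
`ι_{μ_∞} Tr₂( r^trig₁₂(λ,μ) X(μ_∞)₂ ) = Σ_{r≥−N} μ_∞^r ( λ_∞^{−r} X(λ_∞) )^trig_−`.

The trigonometric pole parts (on coefficient functions of a `λ`-Laurent series `c`):
* at `0`: keep `c n` for `n<0` and replace the constant term by `(P⁻+½P⁰)c₀`;
* at `b ∈ ℂ×`: keep `c n` for `n<0`, constant term `−(P⁻+½P⁰)(Σ_{n<0} (−b)^n c_n)`
  (the rational pole part evaluated at `λ = 0`);
* at `∞`: keep `c n` for `n<0` and replace the constant term by `(P⁺+½P⁰)c₀`.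

Identities are coefficientwise in `μ_a^m λ_a^t` (resp. `μ_∞^m λ_∞^t`).
-/

noncomputable section

def lowP {N : ℕ} (M : glC N) : glC N := Matrix.of fun i j => if j < i then M i j else 0
def upP {N : ℕ} (M : glC N) : glC N := Matrix.of fun i j => if i < j then M i j else 0
def diagP {N : ℕ} (M : glC N) : glC N := Matrix.of fun i j => if i = j then M i j else 0

/-- coefficient of `μ_a^p λ_a^t` in the expansion
`ι_{μ_a}(μ/(μ−λ)) = −(μ_a + a) Σ_{s≥0} μ_a^s λ_a^{−s−1}` at a finite point `a` -/
def trigGeomFin (a : ℂ) (p t : ℤ) : ℂ :=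
  (if t < 0 ∧ p = -t then (-1 : ℂ) else 0) + (if t < 0 ∧ p = -t - 1 then -a else 0)

/-- coefficient of `μ_∞^p λ_∞^t` in the expansion
`ι_{μ_∞}(μ/(μ−λ)) = Σ_{s≥0} μ_∞^s λ_∞^{−s}` at infinity -/
def trigGeomInf (p t : ℤ) : ℂ := if 0 ≤ p ∧ t = -p then 1 else 0

/-- trigonometric pole part, on the coefficient function `c` of a `λ`-Laurent series,
at the finite point `a` (case distinction `a = 0` / `a ∈ ℂ×`) -/
def trigNegAt {N : ℕ} (a : ℂ) (c : ℤ → glC N) : ℤ → glC N :=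
  if a = 0 then
    fun t => if t < 0 then c t
      else if t = 0 then lowP (c 0) + (2:ℂ)⁻¹ • diagP (c 0) else 0
  else
    fun t => if t < 0 then c t
      else if t = 0 then
        - (lowP (∑ᶠ n : ℤ, if n < 0 then ((-a) ^ n : ℂ) • c n else 0)
           + (2:ℂ)⁻¹ • diagP (∑ᶠ n : ℤ, if n < 0 then ((-a) ^ n : ℂ) • c n else 0))
      else 0

/-- trigonometric pole part at infinity, on coefficient functions -/
def trigNegInf {N : ℕ} (c : ℤ → glC N) : ℤ → glC N :=
  fun t => if t < 0 then c t
    else if t = 0 then upP (c 0) + (2:ℂ)⁻¹ • diagP (c 0) else 0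

theorem sum_Ico_neg_sub_succ {G : Type*} [AddCommGroup G] (f : ℤ → G) (k : ℕ) :
    ∑ n ∈ Finset.Ico (-(k : ℤ)) 0, (f n - f (n + 1)) = f (-(k : ℤ)) - f 0 := by
  induction k with
  | zero => simp
  | succ k ih =>
    have h : Finset.Ico (-((k + 1 : ℕ) : ℤ)) 0
        = insert (-((k + 1 : ℕ) : ℤ)) (Finset.Ico (-(k : ℤ)) 0) := by
      ext n
      simp only [Finset.mem_Ico, Finset.mem_insert]
      omega
    have h' : -((k + 1 : ℕ) : ℤ) + 1 = -(k : ℤ) := by omega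
    rw [h, Finset.sum_insert (by simp), ih, h']
    abel

/-- Telescoping over the negative integers for a sequence vanishing near `-∞`. -/
theorem finsum_neg_sub_succ {G : Type*} [AddCommGroup G] (f : ℤ → G) (b : ℤ)
    (hf : ∀ n, n < b → f n = 0) :
    (∑ᶠ n : ℤ, if n < 0 then f n - f (n + 1) else 0) = -f 0 := by
  have hsupp : (Function.support fun n : ℤ => if n < 0 then f n - f (n + 1) else 0)
      ⊆ (Finset.Ico (-((b.natAbs + 1 : ℕ) : ℤ)) 0 : Finset ℤ) := by
    intro n hn
    by_contra hmem
    refine hn ?_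
    simp only [Finset.coe_Ico, Set.mem_Ico, not_and, not_lt] at hmem
    by_cases hneg : n < 0
    · simp [hneg, hf n (by omega), hf (n + 1) (by omega)]
    · simp [hneg]
  rw [finsum_eq_sum_of_support_subset _ hsupp,
    Finset.sum_congr rfl fun n hn => if_pos (Finset.mem_Ico.mp hn).2,
    sum_Ico_neg_sub_succ, hf _ (by omega), zero_sub]

theorem lowP_neg {N : ℕ} (M : glC N) : lowP (-M) = -lowP M := by
  ext i j
  simp only [lowP, Matrix.of_apply, Matrix.neg_apply]
  split_ifs <;> simp

theorem diagP_neg {N : ℕ} (M : glC N) : diagP (-M) = -diagP M := by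
  ext i j
  simp only [diagP, Matrix.of_apply, Matrix.neg_apply]
  split_ifs <;> simp

theorem sub_lowP_add_half_diagP {N : ℕ} (M : glC N) :
    M - (lowP M + (2 : ℂ)⁻¹ • diagP M) = upP M + (2 : ℂ)⁻¹ • diagP M := by
  ext i j
  rcases lt_trichotomy i j with h | h | h
  · simp [lowP, upP, diagP, h, h.not_gt, h.ne]
  · simp [lowP, upP, diagP, h]
    ring
  · simp [lowP, upP, diagP, h, h.not_gt, h.ne']

theorem finsum_trigGeomFin_smul {N : ℕ} (a : ℂ) (X : ℤ → glC N) (m t : ℤ) :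
    (∑ᶠ p : ℤ, trigGeomFin a p t • X (m - p))
      = if t < 0 then -(X (t + m) + a • X (t + m + 1)) else 0 := by
  by_cases ht : t < 0
  · have hsupp : (Function.support fun p : ℤ => trigGeomFin a p t • X (m - p))
        ⊆ (({-t, -t - 1} : Finset ℤ) : Set ℤ) := by
      intro p hp
      by_contra hmem
      refine hp ?_
      simp only [Finset.coe_insert, Finset.coe_singleton, Set.mem_insert_iff,
        Set.mem_singleton_iff, not_or] at hmem
      simp [trigGeomFin, hmem.1, hmem.2]
    rw [finsum_eq_sum_of_support_subset _ hsupp, Finset.sum_pair (by omega), if_pos ht]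
    have h₁ : m - -t = t + m := by ring
    have h₂ : m - (-t - 1) = t + m + 1 := by ring
    have h₃ : -t ≠ -t - 1 := by omega
    simp only [trigGeomFin, h₁, h₂, ht, h₃, h₃.symm, true_and, if_true, if_false]
    module
  · simp [trigGeomFin, ht]

theorem finsum_trigGeomInf_smul {N : ℕ} (X : ℤ → glC N) (m t : ℤ) :
    (∑ᶠ p : ℤ, trigGeomInf p t • X (m - p)) = if t ≤ 0 then X (t + m) else 0 := by
  rw [finsum_eq_single _ (-t) fun p hp => by
    rw [trigGeomInf, if_neg (by omega), zero_smul]]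
  have h : m - -t = t + m := by ring
  by_cases ht : t ≤ 0
  · simp [trigGeomInf, ht, h]
  · simp [trigGeomInf, ht]

/-- The rational pole part of `(λ_a^{-m} + a λ_a^{-m-1}) X(λ_a)` evaluated at `λ = 0`. -/
theorem finsum_neg_zpow_smul {N : ℕ} {a : ℂ} (ha : a ≠ 0) (X : ℤ → glC N) (b m : ℤ)
    (hX : ∀ n, n < b → X n = 0) :
    (∑ᶠ n : ℤ, if n < 0 then ((-a) ^ n : ℂ) • (X (n + m) + a • X (n + m + 1)) else 0)
      = -X m := by
  have h := finsum_neg_sub_succ (fun n : ℤ => ((-a) ^ n : ℂ) • X (n + m)) (b - m)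
    fun n hn => by simp [hX (n + m) (by omega)]
  simp only [zpow_zero, one_smul, zero_add] at h
  rw [← h]
  refine finsum_congr fun n => ?_
  congr 1
  rw [zpow_add_one₀ (neg_ne_zero.mpr ha), add_right_comm n 1 m]
  module

/-- the trigonometric expansion lemma, coefficientwise.  For a Laurent
series with coefficients `X n` vanishing for `n < −Nb`:

at a finite point `a ∈ ℂ`, the coefficient of `μ_a^m λ_a^t` of
`ι_{μ_a}Tr₂(r^trig₁₂(λ,μ) X(μ_a)₂)` equals that of
`−Σ_r μ_a^r ((λ_a^{−r} + a λ_a^{−r−1})X(λ_a))^trig_−`;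

at infinity, the coefficient of `μ_∞^m λ_∞^t` of `ι_{μ_∞}Tr₂(r^trig₁₂(λ,μ) X(μ_∞)₂)`
equals that of `Σ_r μ_∞^r (λ_∞^{−r}X(λ_∞))^trig_−`. -/
theorem trigonometric_expansion_lemma (N : ℕ) (a : ℂ) (Nb : ℤ) (X : ℤ → glC N)
    (hX : ∀ n, n < -Nb → X n = 0) :
    (∀ m t : ℤ,
      (∑ᶠ p : ℤ, trigGeomFin a p t • X (m - p))
          - (if t = 0 then lowP (X m) + (2:ℂ)⁻¹ • diagP (X m) else 0)
        = - trigNegAt a (fun u => X (u + m) + a • X (u + m + 1)) t) ∧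
    (∀ m t : ℤ,
      (∑ᶠ p : ℤ, trigGeomInf p t • X (m - p))
          - (if t = 0 then lowP (X m) + (2:ℂ)⁻¹ • diagP (X m) else 0)
        = trigNegInf (fun u => X (u + m)) t) := by
  refine ⟨fun m t => ?_, fun m t => ?_⟩
  · rw [finsum_trigGeomFin_smul]
    rcases lt_trichotomy t 0 with ht | rfl | ht
    · by_cases ha : a = 0 <;> simp [trigNegAt, ha, ht, ht.ne]
    · by_cases ha : a = 0
      · simp [trigNegAt, ha]
      · simp only [trigNegAt, ha, if_false, lt_irrefl, if_true,
          finsum_neg_zpow_smul ha X (-Nb) m hX, lowP_neg, diagP_neg]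
        module
    · by_cases ha : a = 0 <;> simp [trigNegAt, ha, ht.not_gt, ht.ne']
  · rw [finsum_trigGeomInf_smul]
    rcases lt_trichotomy t 0 with ht | rfl | ht
    · simp [trigNegInf, ht, ht.le, ht.ne]
    · simpa [trigNegInf] using sub_lowP_add_half_diagP (X m)
    · simp [trigNegInf, ht.not_gt, ht.not_ge, ht.ne']

end
end

section
/- Equivalence of the two recursion systems for the sine-Gordon hierarchy: let A be a commutative ℂ-algebra with a ℂ-linear derivation ∂, and let a(λ), b(λ), c(λ) be formal Laurent series in λ with coefficients in A; write a₀, b₀ for the constant (λ⁰) coefficients of a(λ), b(λ) and c₋₁ for the λ^{-1} coefficient of c(λ). Consider the systems (I): ∂a(λ) = b₀ c(λ) − λ^{-1} c₋₁ b(λ), ∂b(λ) = a₀ b(λ) − 2 b₀ a(λ), ∂c(λ) = −a₀ c(λ) + 2 λ^{-1} c₋₁ a(λ); and (II): the first two equations of (I) together with a(λ)² + b(λ)c(λ) = −λ/4. Then: (i) if (I) holds, then ∂( a(λ)² + b(λ)c(λ) ) = 0; (ii) if (II) holds, then b(λ) · ( ∂c(λ) + a₀ c(λ) − 2 λ^{-1}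 c₋₁ a(λ) ) = 0, and hence if in addition b(λ) is not a zero divisor in the ring of Laurent series over A (for instance if b(λ) ∈ A[[λ]] with b₀ invertible in A), then the third equation of (I) holds, so (I) holds. -/
/-!
# Equivalence of the two recursion systems for the sine-Gordon hierarchy

`A` is a commutative `ℂ`-algebra with a `ℂ`-linear derivation `∂`, extended
coefficientwise to the ring `A((λ)) = LaurentSeries A` of formal Laurent series (so
`∂λ = 0`, and the Leibniz rule holds for products of series).  For Laurent series
`a(λ), b(λ), c(λ)` write `a₀ = a.coeff 0`, `b₀ = b.coeff 0`, `c₋₁ = c.coeff (−1)`,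
and `λ^{-1} = HahnSeries.single (−1) 1`.  Consider the systems

(I):  `∂a(λ) = b₀c(λ) − λ^{-1}c₋₁b(λ)`,  `∂b(λ) = a₀b(λ) − 2b₀a(λ)`,
      `∂c(λ) = −a₀c(λ) + 2λ^{-1}c₋₁a(λ)`;
(II): the first two equations of (I) together with `a(λ)² + b(λ)c(λ) = −λ/4`
      (the series with the single term `−(1/4)λ`).

Then: (i) if (I) holds, `∂(a(λ)² + b(λ)c(λ)) = 0`; (ii) if (II) holds, then
`b(λ)·(∂c(λ) + a₀c(λ) − 2λ^{-1}c₋₁a(λ)) = 0`, and hence if moreover `b(λ)` is not a zero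
divisor in `A((λ))` (for instance if `b ∈ A[[λ]]` with `b₀` invertible), then the third
equation of (I) holds.
-/

noncomputable section

/-- coefficientwise extension of a `ℂ`-linear map of `A` to formal Laurent series
(`LaurentSeries A = HahnSeries ℤ A`) -/
def mapD {A : Type*} [CommRing A] [Algebra ℂ A] (f : A →ₗ[ℂ] A)
    (x : LaurentSeries A) : LaurentSeries A where
  coeff n := f (x.coeff n)
  isPWO_support' := x.isPWO_support.mono (by
    intro n hn
    simp only [Function.mem_support] at hn ⊢
    intro hc
    exact hn (by rw [hc, map_zero]))

/-- The coefficientwise extension of a linear map is additive. -/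
theorem mapD_add {A : Type*} [CommRing A] [Algebra ℂ A] (f : A →ₗ[ℂ] A)
    (x y : LaurentSeries A) : mapD f (x + y) = mapD f x + mapD f y := by
  ext n
  simp [mapD]

theorem support_mapD_subset {A : Type*} [CommRing A] [Algebra ℂ A] (f : A →ₗ[ℂ] A)
    (x : LaurentSeries A) : (mapD f x).support ⊆ x.support := by
  intro n hn hx
  exact hn (by simp [mapD, hx])

/-- The coefficientwise extension of a derivation satisfies the Leibniz rule. -/
theorem mapD_mul {A : Type*} [CommRing A] [Algebra ℂ A] (der : Derivation ℂ A A)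
    (x y : LaurentSeries A) :
    mapD (der : A →ₗ[ℂ] A) (x * y)
      = mapD (der : A →ₗ[ℂ] A) x * y + x * mapD (der : A →ₗ[ℂ] A) y := by
  ext n
  rw [HahnSeries.coeff_add,
    HahnSeries.coeff_mul_left' x.isPWO_support (support_mapD_subset _ x),
    HahnSeries.coeff_mul_right' y.isPWO_support (support_mapD_subset _ y),
    ← Finset.sum_add_distrib]
  change der ((x * y).coeff n) = _
  rw [HahnSeries.coeff_mul, map_sum]
  refine Finset.sum_congr rfl fun p _ => ?_
  simp only [mapD, Derivation.leibniz, smul_eq_mul, Derivation.coeFn_coe]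
  ring

/-- The coefficientwise extension of a derivation kills monomials with scalar coefficient. -/
theorem mapD_single_algebraMap {A : Type*} [CommRing A] [Algebra ℂ A]
    (der : Derivation ℂ A A) (k : ℤ) (z : ℂ) :
    mapD (der : A →ₗ[ℂ] A) (HahnSeries.single k (algebraMap ℂ A z)) = 0 := by
  ext n
  simp only [mapD, HahnSeries.coeff_single, Derivation.coeFn_coe, HahnSeries.coeff_zero]
  split_ifs <;> simp

/-- equivalence of the two recursion systems for the sine-Gordon
hierarchy. -/
theorem sineGordon_recursion_equivalence {A : Type*} [CommRing A] [Algebra ℂ A]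
    (der : Derivation ℂ A A) (a b c : LaurentSeries A) :
    -- (i): system (I) implies `∂(a² + bc) = 0`
    ((mapD (der : A →ₗ[ℂ] A) a
        = b.coeff 0 • c - c.coeff (-1) • (HahnSeries.single (-1 : ℤ) (1 : A) * b)) →
     (mapD (der : A →ₗ[ℂ] A) b = a.coeff 0 • b - (2 * b.coeff 0) • a) →
     (mapD (der : A →ₗ[ℂ] A) c
        = -(a.coeff 0) • c
          + (2 * c.coeff (-1)) • (HahnSeries.single (-1 : ℤ) (1 : A) * a)) →
     mapD (der : A →ₗ[ℂ] A) (a * a + b * c) = 0) ∧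
    -- (ii): system (II) implies `b · (residual of the third equation) = 0`, and if `b`
    -- is not a zero divisor then the third equation of (I) holds
    ((mapD (der : A →ₗ[ℂ] A) a
        = b.coeff 0 • c - c.coeff (-1) • (HahnSeries.single (-1 : ℤ) (1 : A) * b)) →
     (mapD (der : A →ₗ[ℂ] A) b = a.coeff 0 • b - (2 * b.coeff 0) • a) →
     (a * a + b * c = HahnSeries.single (1 : ℤ) (-(algebraMap ℂ A 4⁻¹))) →
     (b * (mapD (der : A →ₗ[ℂ] A) c + (a.coeff 0) • c
        - (2 * c.coeff (-1)) • (HahnSeries.single (-1 : ℤ) (1 : A) * a)) = 0) ∧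
     (b ∈ nonZeroDivisors (LaurentSeries A) →
       mapD (der : A →ₗ[ℂ] A) c
         = -(a.coeff 0) • c
           + (2 * c.coeff (-1)) • (HahnSeries.single (-1 : ℤ) (1 : A) * a))) := by
  simp only [← HahnSeries.C_mul_eq_smul, map_mul, map_neg, map_ofNat]
  refine ⟨fun ha hb hc => ?_, fun ha hb habc => ?_⟩
  · rw [mapD_add, mapD_mul, mapD_mul, ha, hb, hc]
    ring
  · have hD : mapD (der : A →ₗ[ℂ] A) (a * a + b * c) = 0 := by
      rw [habc, ← map_neg (algebraMap ℂ A), mapD_single_algebraMap]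
    rw [mapD_add, mapD_mul, mapD_mul, ha, hb] at hD
    have hres : b * (mapD (der : A →ₗ[ℂ] A) c + HahnSeries.C (a.coeff 0) * c
        - 2 * HahnSeries.C (c.coeff (-1)) * (HahnSeries.single (-1 : ℤ) (1 : A) * a)) = 0 := by
      linear_combination hD
    refine ⟨hres, fun hreg => ?_⟩
    linear_combination (mul_left_mem_nonZeroDivisors_eq_zero_iff hreg).mp hres
end
end
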